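/- The map Cal₁ : Diff¹_ω(D) → ℝ is continuous with respect to the C¹ distance d₁: for every f ∈ Diff¹_ω(D) and every ε > 0 there exists δ > 0 such that every g ∈ Diff¹_ω(D) with d₁(f, g) ≤ δ satisfies |Cal₁(f) − Cal₁(g)| ≤ ε. -/

import Mathlib

open MeasureTheory Metric Set Filter Topology
open scoped Real

noncomputable section

/-- The closed unit disk in `ℂ ≅ ℝ²`. -/
def Disk : Set ℂ := Metric.closedBall 0 1

/-- The unit circle, boundary of the closed unit disk. -/
def Circ : Set ℂ := Metric.sphere 0 1

/-- The standard Liouville form `λ_z(w) = (z₁ w₂ - z₂ w₁)/(2π)`, whose exterior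
derivative is the normalized area form `ω = (1/π) du ∧ dv`. -/
def lform (z w : ℂ) : ℝ := (z.re * w.im - z.im * w.re) / (2 * Real.pi)

/-- An element of `Diff¹_ω(D)`: a `C¹` diffeomorphism of the closed unit disk onto itself
whose Jacobian determinant equals `1` at every point. -/
structure SympDiff where
  toFun : ℂ → ℂ
  invFun : ℂ → ℂ
  mapsTo : Set.MapsTo toFun Disk Disk
  inv_mapsTo : Set.MapsTo invFun Disk Disk
  left_inv : ∀ z ∈ Disk, invFun (toFun z) = z
  right_inv : ∀ z ∈ Disk, toFun (invFun z) = z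
  contDiffOn : ContDiffOn ℝ 1 toFun Disk
  inv_contDiffOn : ContDiffOn ℝ 1 invFun Disk
  jacobian : ∀ z ∈ Disk,
    LinearMap.det (fderivWithin ℝ toFun Disk z).toLinearMap = 1

/-- `A` is an action function of `f`: a `C¹` function with `dA = f*λ - λ` on the disk. -/
def IsAction (f : SympDiff) (A : ℂ → ℝ) : Prop :=
  ContDiffOn ℝ 1 A Disk ∧
    ∀ z ∈ Disk, ∀ w : ℂ,
      fderivWithin ℝ A Disk z w =
        lform (f.toFun z) (fderivWithin ℝ f.toFun Disk z w) - lform z w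

/-- `μ` is a Borel probability measure concentrated on the unit circle and invariant
under `f|_{S¹}`. -/
def IsInvariantCircleMeasure (f : SympDiff) (μ : Measure ℂ) : Prop :=
  IsProbabilityMeasure μ ∧ μ Circᶜ = 0 ∧ Measure.map f.toFun μ = μ

/-- `A` is a normalized action function of `f`: an action function whose integral over the
circle with respect to some `f|_{S¹}`-invariant probability measure vanishes. -/
def IsNormalizedAction (f : SympDiff) (A : ℂ → ℝ) : Prop :=
  IsAction f A ∧
    ∃ μ : Measure ℂ, IsInvariantCircleMeasure f μ ∧ ∫ z, A z ∂μ = 0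

/-- The `C⁰` distance between two disk diffeomorphisms (given with their inverses). -/
def d0 (f fi g gi : ℂ → ℂ) : ℝ :=
  max (⨆ z : Disk, ‖f (z : ℂ) - g (z : ℂ)‖) (⨆ z : Disk, ‖fi (z : ℂ) - gi (z : ℂ)‖)

/-- The `C¹` distance between two disk diffeomorphisms (given with their inverses). -/
def d1 (f fi g gi : ℂ → ℂ) : ℝ :=
  max (d0 f fi g gi)
    (max (⨆ z : Disk, ‖fderivWithin ℝ f Disk (z : ℂ) - fderivWithin ℝ g Disk (z : ℂ)‖)
      (⨆ z : Disk, ‖fderivWithin ℝ fi Disk (z : ℂ) - fderivWithin ℝ gi Disk (z : ℂ)‖))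

theorem convex_disk : Convex ℝ Disk := convex_closedBall 0 1

theorem isCompact_disk : IsCompact Disk := isCompact_closedBall 0 1

theorem uniqueDiffOn_disk : UniqueDiffOn ℝ Disk :=
  uniqueDiffOn_convex convex_disk ⟨0, by
    rw [Disk, interior_closedBall (0 : ℂ) one_ne_zero]; simp⟩

theorem circ_subset_disk : Circ ⊆ Disk := sphere_subset_closedBall

theorem isCompact_circ : IsCompact Circ := isCompact_sphere 0 1

theorem norm_le_one_of_mem_disk {z : ℂ} (hz : z ∈ Disk) : ‖z‖ ≤ 1 := by
  simpa [Disk] using hz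

theorem lform_eq (z w : ℂ) :
    lform z w = (starRingEnd ℂ z * w).im / (2 * Real.pi) := by
  simp [lform, Complex.mul_im]; ring

theorem abs_lform_le (z w : ℂ) : |lform z w| ≤ ‖z‖ * ‖w‖ := by
  have h1 : |(starRingEnd ℂ z * w).im| ≤ ‖z‖ * ‖w‖ := by
    simpa using Complex.abs_im_le_norm (starRingEnd ℂ z * w)
  have h2 : (1 : ℝ) ≤ 2 * Real.pi := by linarith [Real.pi_gt_three]
  rw [lform_eq, abs_div, abs_of_pos (by positivity : (0 : ℝ) < 2 * Real.pi)]
  exact (div_le_self (abs_nonneg _) h2).trans h1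

theorem lform_sub_lform (z z' w w' : ℂ) :
    lform z' w' - lform z w = lform (z' - z) w' + lform z (w' - w) := by
  simp only [lform, Complex.sub_re, Complex.sub_im]; ring

namespace SympDiff

variable (f : SympDiff)

theorem continuousOn : ContinuousOn f.toFun Disk := f.contDiffOn.continuousOn

theorem hasFDerivWithinAt {z : ℂ} (hz : z ∈ Disk) :
    HasFDerivWithinAt f.toFun (fderivWithin ℝ f.toFun Disk z) Disk z :=
  (f.contDiffOn.differentiableOn one_ne_zero z hz).hasFDerivWithinAt

theorem inv_hasFDerivWithinAt {z : ℂ} (hz : z ∈ Disk) :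
    HasFDerivWithinAt f.invFun (fderivWithin ℝ f.invFun Disk z) Disk z :=
  (f.inv_contDiffOn.differentiableOn one_ne_zero z hz).hasFDerivWithinAt

theorem injOn : InjOn f.toFun Disk := fun x hx y hy h => by
  rw [← f.left_inv x hx, ← f.left_inv y hy, h]

theorem fderivWithin_inv_comp {z : ℂ} (hz : z ∈ Disk) (v : ℂ) :
    fderivWithin ℝ f.invFun Disk (f.toFun z) (fderivWithin ℝ f.toFun Disk z v) = v := by
  have h := (f.inv_hasFDerivWithinAt (f.mapsTo hz)).comp z (f.hasFDerivWithinAt hz) f.mapsTo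
  have h' : HasFDerivWithinAt (f.invFun ∘ f.toFun) (ContinuousLinearMap.id ℝ ℂ) Disk z :=
    (hasFDerivWithinAt_id z Disk).congr (fun x hx => f.left_inv x hx) (f.left_inv z hz)
  exact DFunLike.congr_fun ((uniqueDiffOn_disk z hz).eq h h') v

/-- A disk diffeomorphism preserves the boundary circle. -/
theorem mapsTo_circ : MapsTo f.toFun Circ Circ := by
  intro z hz
  have hzD := circ_subset_disk hz
  have hwD := f.mapsTo hzD
  by_contra hw
  set w := f.toFun z with hwdef
  have hball : w ∈ ball (0 : ℂ) 1 := by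
    have h1 : ‖w‖ ≤ 1 := norm_le_one_of_mem_disk hwD
    have h2 : ‖w‖ ≠ 1 := by simpa [Circ] using hw
    simpa using lt_of_le_of_ne h1 h2
  have hnhds : Disk ∈ 𝓝 w := Filter.mem_of_superset (isOpen_ball.mem_nhds hball)
    ball_subset_closedBall
  have hd := ((f.inv_hasFDerivWithinAt hwD).hasFDerivAt hnhds).norm_sq
  have hinv : f.invFun w = z := f.left_inv z hzD
  have hznorm : ‖z‖ = 1 := by simpa [Circ] using hz
  have hmax : IsLocalMax (fun x => ‖f.invFun x‖ ^ 2) w := by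
    filter_upwards [hnhds] with x hx
    rw [hinv, hznorm]
    exact pow_le_pow_left₀ (norm_nonneg _) (norm_le_one_of_mem_disk (f.inv_mapsTo hx)) 2
  have h0 := DFunLike.congr_fun (hmax.hasFDerivAt_eq_zero hd) (fderivWithin ℝ f.toFun Disk z z)
  have h3 := f.fderivWithin_inv_comp hzD z
  rw [← hwdef] at h3
  simp [hinv, h3, hznorm] at h0

end SympDiff

/-- The standard parametrization `t ↦ exp (2πit)` of the unit circle. -/
def circleParam (t : ℝ) : ℂ := Complex.exp ((2 * Real.pi * t : ℝ) * Complex.I)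

theorem norm_circleParam (t : ℝ) : ‖circleParam t‖ = 1 := Complex.norm_exp_ofReal_mul_I _

theorem circleParam_mem_circ (t : ℝ) : circleParam t ∈ Circ := by
  simp [Circ, norm_circleParam]

theorem circleParam_mem_disk (t : ℝ) : circleParam t ∈ Disk :=
  circ_subset_disk (circleParam_mem_circ t)

theorem circleParam_add (s t : ℝ) : circleParam (s + t) = circleParam s * circleParam t := by
  simp only [circleParam, ← Complex.exp_add]; congr 1; push_cast; ring

theorem exists_circleParam_eq {z : ℂ} (hz : ‖z‖ = 1) : ∃ t, circleParam t = z := by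
  refine ⟨z.arg / (2 * Real.pi), ?_⟩
  have h : 2 * Real.pi * (z.arg / (2 * Real.pi)) = z.arg := by field_simp
  rw [circleParam, h]
  simpa [hz] using Complex.norm_mul_exp_arg_mul_I z

theorem circleParam_eq_iff {s t : ℝ} :
    circleParam s = circleParam t ↔ ∃ n : ℤ, s = t + n := by
  simp only [circleParam, Complex.exp_eq_exp_iff_exists_int]
  refine exists_congr fun n => ?_
  have h : (2 * Real.pi : ℂ) * Complex.I ≠ 0 := Complex.two_pi_I_ne_zero
  have e1 : ((2 * Real.pi * s : ℝ) : ℂ) * Complex.I = s * (2 * Real.pi * Complex.I) := by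
    push_cast; ring
  have e2 : ((2 * Real.pi * t : ℝ) : ℂ) * Complex.I + n * (2 * Real.pi * Complex.I)
      = (t + n) * (2 * Real.pi * Complex.I) := by
    push_cast; ring
  rw [e1, e2, mul_left_inj' h]
  exact_mod_cast Iff.rfl

theorem hasDerivAt_circleParam_comp {φ : ℝ → ℝ} {φ' t : ℝ} (h : HasDerivAt φ φ' t) :
    HasDerivAt (fun s => circleParam (φ s))
      (circleParam (φ t) * ((2 * Real.pi * φ' : ℝ) * Complex.I)) t :=
  (((h.const_mul (2 * Real.pi)).ofReal_comp).mul_const Complex.I).cexp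

theorem hasDerivAt_circleParam (t : ℝ) :
    HasDerivAt circleParam (circleParam t * ((2 * Real.pi : ℝ) * Complex.I)) t := by
  simpa using hasDerivAt_circleParam_comp (hasDerivAt_id t)

theorem continuous_circleParam : Continuous circleParam :=
  continuous_iff_continuousAt.2 fun t => (hasDerivAt_circleParam t).continuousAt

theorem lform_circleParam (t : ℝ) :
    lform (circleParam t) (circleParam t * ((2 * Real.pi : ℝ) * Complex.I)) = 1 := by
  have h : starRingEnd ℂ (circleParam t) * circleParam t = 1 := by
    rw [Complex.conj_mul', norm_circleParam]; simp
  rw [lform_eq, ← mul_assoc, h, one_mul, Complex.im_ofReal_mul, Complex.I_im, mul_one]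
  exact div_self (by positivity)

/-- A curve on the unit circle whose angular velocity is `φ'` agrees with `φ` in the standard
parametrization, up to an additive constant. -/
theorem exists_lift_of_lform_deriv {h h' : ℝ → ℂ} {φ : ℝ → ℝ} (hn : ∀ t, ‖h t‖ = 1)
    (hh : ∀ t, HasDerivAt h (h' t) t) (hφ : ∀ t, HasDerivAt φ (lform (h t) (h' t)) t) :
    ∃ c, ∀ t, h t = circleParam (φ t + c) := by
  have hder : ∀ t, h' t = h t * ((2 * Real.pi * lform (h t) (h' t) : ℝ) * Complex.I) := by
    intro t
    have h1 : starRingEnd ℂ (h t) * h t = 1 := by rw [Complex.conj_mul', hn]; simp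
    have hre : (starRingEnd ℂ (h t) * h' t).re = 0 := by
      have h2 := (hh t).norm_sq
      have h3 : HasDerivAt (fun s => ‖h s‖ ^ 2) 0 t := by
        simpa [hn] using hasDerivAt_const t (1 : ℝ)
      have h4 := h2.unique h3
      rw [Complex.inner, mul_comm (h' t)] at h4
      linarith
    have him : 2 * Real.pi * lform (h t) (h' t) = (starRingEnd ℂ (h t) * h' t).im := by
      rw [lform_eq]; field_simp
    have h5 : starRingEnd ℂ (h t) * h' t
        = ((starRingEnd ℂ (h t) * h' t).im : ℂ) * Complex.I := by
      apply Complex.ext <;> simp only [Complex.re_ofReal_mul, Complex.im_ofReal_mul,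
        Complex.I_re, Complex.I_im, mul_zero, mul_one, hre]
    rw [him, ← h5, ← mul_assoc, mul_comm (h t), h1, one_mul]
  have hq : ∀ t, HasDerivAt (fun s => h s * circleParam (-φ s)) 0 t := by
    intro t
    have := (hh t).mul (hasDerivAt_circleParam_comp (hφ t).neg)
    refine this.congr_deriv ?_
    nth_rewrite 1 [hder t]
    push_cast
    ring
  obtain ⟨c, hc⟩ := exists_circleParam_eq (z := h 0 * circleParam (-φ 0))
    (by rw [norm_mul, hn, norm_circleParam, one_mul])
  refine ⟨c, fun t => ?_⟩
  have hconst := is_const_of_deriv_eq_zero (fun t => (hq t).differentiableAt)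
    (fun t => (hq t).deriv) t 0
  have hcancel : circleParam (-φ t) * circleParam (φ t) = 1 := by
    rw [← circleParam_add]; simp [circleParam]
  rw [add_comm, circleParam_add, hc]
  rw [← hconst, mul_assoc, hcancel, mul_one]

namespace IsAction

variable {f : SympDiff} {A : ℂ → ℝ}

theorem continuousOn (hA : IsAction f A) : ContinuousOn A Disk := hA.1.continuousOn

theorem hasFDerivWithinAt (hA : IsAction f A) {z : ℂ} (hz : z ∈ Disk) :
    HasFDerivWithinAt A (fderivWithin ℝ A Disk z) Disk z :=
  (hA.1.differentiableOn one_ne_zero z hz).hasFDerivWithinAt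

/-- On the boundary circle, an action function is the displacement of a lift of `f`, up to an
additive constant. -/
theorem exists_lift (hA : IsAction f A) :
    ∃ c, ∀ t, f.toFun (circleParam t) = circleParam (A (circleParam t) + t + c) := by
  have hd : ∀ {F : Type} [NormedAddCommGroup F] [NormedSpace ℝ F] {u : ℂ → F} {L : ℂ →L[ℝ] F}
      (t : ℝ), HasFDerivWithinAt u L Disk (circleParam t) →
      HasDerivAt (fun s => u (circleParam s))
        (L (circleParam t * ((2 * Real.pi : ℝ) * Complex.I))) t := fun t hu =>
    hu.comp_hasDerivAt t (hasDerivAt_circleParam t) (Eventually.of_forall circleParam_mem_disk)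
  refine exists_lift_of_lform_deriv (fun t => ?_)
    (fun t => hd t (f.hasFDerivWithinAt (circleParam_mem_disk t))) (fun t => ?_)
  · simpa [Circ] using f.mapsTo_circ (circleParam_mem_circ t)
  · refine ((hd t (hA.hasFDerivWithinAt (circleParam_mem_disk t))).add
      (hasDerivAt_id t)).congr_deriv ?_
    rw [hA.2 _ (circleParam_mem_disk t), lform_circleParam, sub_add_cancel]

end IsAction

theorem exists_circleParam_eq_mem_Ico {z : ℂ} (hz : ‖z‖ = 1) (s : ℝ) :
    ∃ t ∈ Ico s (s + 1), circleParam t = z := by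
  obtain ⟨t, rfl⟩ := exists_circleParam_eq hz
  refine ⟨t - ⌊t - s⌋, ⟨?_, ?_⟩, circleParam_eq_iff.2 ⟨-⌊t - s⌋, by push_cast; ring⟩⟩
  · linarith [Int.floor_le (t - s)]
  · linarith [Int.lt_floor_add_one (t - s)]

/-- A lift of an injective continuous circle map varies by at most `1` over one turn. -/
theorem abs_sub_le_one_of_injective_mod_one {G : ℝ → ℝ} (hG : Continuous G)
    (hinj : ∀ s t, circleParam (G s) = circleParam (G t) → circleParam s = circleParam t)
    {s t : ℝ} (ht : t ∈ Ico s (s + 1)) : |G t - G s| ≤ 1 := by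
  have key : ∀ r ∈ Icc s t, ∀ n : ℤ, G r = G s + n → n = 0 := by
    intro r hr n hn
    obtain ⟨m, hm⟩ := circleParam_eq_iff.1 (hinj r s (circleParam_eq_iff.2 ⟨n, hn⟩))
    have h1 : (m : ℝ) < 1 := by linarith [hr.2, ht.2]
    have h2 : (-1 : ℝ) < m := by linarith [hr.1]
    have h3 : m = 0 := by
      have h1' : m < 1 := by exact_mod_cast h1
      have h2' : -1 < m := by exact_mod_cast h2
      omega
    have h4 : (n : ℝ) = 0 := by
      rw [h3, Int.cast_zero, add_zero] at hm
      rw [hm] at hn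
      linarith
    exact_mod_cast h4
  by_contra! hlt
  rcases lt_abs.1 hlt with h | h
  · obtain ⟨r, hr, hr'⟩ := intermediate_value_Icc ht.1 hG.continuousOn
      (show G s + 1 ∈ Icc (G s) (G t) from ⟨by linarith, by linarith⟩)
    exact one_ne_zero (key r hr 1 (by simpa using hr'))
  · obtain ⟨r, hr, hr'⟩ := intermediate_value_Icc' ht.1 hG.continuousOn
      (show G s - 1 ∈ Icc (G t) (G s) from ⟨by linarith, by linarith⟩)
    have := key r hr (-1) (by push_cast; linarith)
    omega

theorem SympDiff.iterate_injOn (f : SympDiff) (n : ℕ) : InjOn f.toFun^[n] Disk :=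
  f.injOn.iterate f.mapsTo n

/-- The Birkhoff sums of an action function oscillate by at most `2` on the boundary circle. -/
theorem IsAction.abs_birkhoffSum_sub_le {f : SympDiff} {A : ℂ → ℝ} (hA : IsAction f A) (n : ℕ)
    {x y : ℂ} (hx : x ∈ Circ) (hy : y ∈ Circ) :
    |birkhoffSum f.toFun A n x - birkhoffSum f.toFun A n y| ≤ 2 := by
  obtain ⟨c, hc⟩ := hA.exists_lift
  set F : ℝ → ℝ := fun t => A (circleParam t) + t + c with hF
  have hFcont : Continuous F :=
    ((hA.continuousOn.comp_continuous continuous_circleParam circleParam_mem_disk).add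
      continuous_id).add continuous_const
  have hsemi : ∀ n t, f.toFun^[n] (circleParam t) = circleParam (F^[n] t) := fun n =>
    ((show Function.Semiconj circleParam F f.toFun from fun t => (hc t).symm).iterate_right n
      · |>.symm)
  have hsum : ∀ n t, F^[n] t = t + birkhoffSum f.toFun A n (circleParam t) + n * c := by
    intro n t
    induction n with
    | zero => simp
    | succ n ih =>
      rw [Function.iterate_succ_apply', birkhoffSum_succ, hsemi]
      simp only [hF] at ih ⊢
      push_cast
      linarith
  obtain ⟨s, -, rfl⟩ := exists_circleParam_eq_mem_Ico (by simpa [Circ] using hy) 0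
  obtain ⟨t, ht, rfl⟩ := exists_circleParam_eq_mem_Ico (z := x) (by simpa [Circ] using hx) s
  have h := abs_sub_le_one_of_injective_mod_one (hFcont.iterate n) (fun a b hab => by
    rw [← hsemi, ← hsemi] at hab
    exact f.iterate_injOn n (circleParam_mem_disk a) (circleParam_mem_disk b) hab) ht
  rw [hsum, hsum] at h
  have h1 := ht.1
  have h2 := ht.2
  rw [abs_le] at h ⊢
  constructor <;> linarith [h.1, h.2]

namespace IsInvariantCircleMeasure

variable {f : SympDiff} {μ : Measure ℂ}

theorem restrict_circ (hμ : IsInvariantCircleMeasure f μ) : μ.restrict Circ = μ :=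
  Measure.restrict_eq_self_of_ae_mem (mem_ae_iff.2 hμ.2.1)

theorem integrable (hμ : IsInvariantCircleMeasure f μ) {ψ : ℂ → ℝ} (hψ : ContinuousOn ψ Circ) :
    Integrable ψ μ := by
  have := hμ.1
  rw [← hμ.restrict_circ]
  exact hψ.integrableOn_compact isCompact_circ

theorem integral_comp (hμ : IsInvariantCircleMeasure f μ) {ψ : ℂ → ℝ}
    (hψ : ContinuousOn ψ Circ) : ∫ z, ψ (f.toFun z) ∂μ = ∫ z, ψ z ∂μ := by
  have hf : AEMeasurable f.toFun μ := by
    rw [← hμ.restrict_circ]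
    exact (f.continuousOn.mono circ_subset_disk).aemeasurable isCompact_circ.measurableSet
  have h := integral_map (μ := μ) hf (f := ψ)
    (by rw [hμ.2.2]; exact (hμ.integrable hψ).aestronglyMeasurable)
  rw [hμ.2.2] at h
  exact h.symm

theorem integral_comp_iterate (hμ : IsInvariantCircleMeasure f μ) {ψ : ℂ → ℝ}
    (hψ : ContinuousOn ψ Circ) (n : ℕ) : ∫ z, ψ (f.toFun^[n] z) ∂μ = ∫ z, ψ z ∂μ := by
  induction n generalizing ψ with
  | zero => rfl
  | succ n ih =>
    simp only [Function.iterate_succ_apply']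
    rw [ih (ψ := fun z => ψ (f.toFun z))
      (hψ.comp (f.continuousOn.mono circ_subset_disk) f.mapsTo_circ), hμ.integral_comp hψ]

theorem integral_birkhoffSum (hμ : IsInvariantCircleMeasure f μ) {ψ : ℂ → ℝ}
    (hψ : ContinuousOn ψ Circ) (n : ℕ) :
    ∫ z, birkhoffSum f.toFun ψ n z ∂μ = n * ∫ z, ψ z ∂μ := by
  simp only [birkhoffSum]
  rw [integral_finsetSum _ fun k _ => hμ.integrable (ψ := fun z => ψ (f.toFun^[k] z)) (hψ.comp
    ((f.continuousOn.mono circ_subset_disk).iterate f.mapsTo_circ k) (f.mapsTo_circ.iterate k))]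
  simp [hμ.integral_comp_iterate hψ]

theorem abs_sub_integral_le (hμ : IsInvariantCircleMeasure f μ) {ψ : ℂ → ℝ}
    (hψ : ContinuousOn ψ Circ) {a C : ℝ} (h : ∀ y ∈ Circ, |a - ψ y| ≤ C) :
    |a - ∫ z, ψ z ∂μ| ≤ C := by
  have := hμ.1
  have h1 : ∫ z, (a - ψ z) ∂μ = a - ∫ z, ψ z ∂μ := by
    rw [integral_sub (integrable_const a) (hμ.integrable hψ)]; simp
  rw [← h1]
  have hae : ∀ᵐ y ∂μ, ‖a - ψ y‖ ≤ C := by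
    filter_upwards [mem_ae_iff.2 hμ.2.1] with y hy using h y hy
  simpa using norm_integral_le_of_norm_le_const hae

end IsInvariantCircleMeasure

theorem SympDiff.continuousOn_birkhoffSum (f : SympDiff) {ψ : ℂ → ℝ} (hψ : ContinuousOn ψ Circ)
    (n : ℕ) : ContinuousOn (birkhoffSum f.toFun ψ n) Circ :=
  continuousOn_finsetSum _ fun k _ => hψ.comp
    ((f.continuousOn.mono circ_subset_disk).iterate f.mapsTo_circ k) (f.mapsTo_circ.iterate k)

/-- The Birkhoff sums of a normalized action function are bounded by `2` on the circle. -/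
theorem IsNormalizedAction.abs_birkhoffSum_le {f : SympDiff} {A : ℂ → ℝ}
    (hA : IsNormalizedAction f A) (n : ℕ) {x : ℂ} (hx : x ∈ Circ) :
    |birkhoffSum f.toFun A n x| ≤ 2 := by
  obtain ⟨hA, μ, hμ, h0⟩ := hA
  have hc := hA.continuousOn.mono circ_subset_disk
  have := hμ.abs_sub_integral_le (f.continuousOn_birkhoffSum hc n)
    fun y hy => hA.abs_birkhoffSum_sub_le n hx hy
  rwa [hμ.integral_birkhoffSum hc, h0, mul_zero, sub_zero] at this

/-- Finitely many iterates of a continuous self-map of the disk depend continuously on it. -/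
theorem exists_forall_iterate_sub_le {f : ℂ → ℂ} (hf : ContinuousOn f Disk)
    (hfD : MapsTo f Disk Disk) (n : ℕ) {ε : ℝ} (hε : 0 < ε) :
    ∃ δ > 0, ∀ g : ℂ → ℂ, MapsTo g Disk Disk → (∀ z ∈ Disk, ‖f z - g z‖ ≤ δ) →
      ∀ z ∈ Disk, ‖f^[n] z - g^[n] z‖ ≤ ε := by
  induction n generalizing ε with
  | zero => exact ⟨1, one_pos, fun g _ _ z _ => by simpa using hε.le⟩
  | succ n ih =>
    obtain ⟨r, hr, hfr⟩ := Metric.uniformContinuousOn_iff_le.1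
      (isCompact_disk.uniformContinuousOn_of_continuous hf) (ε / 2) (half_pos hε)
    obtain ⟨δ, hδ, h⟩ := ih hr
    refine ⟨min δ (ε / 2), lt_min hδ (half_pos hε), fun g hg hfg z hz => ?_⟩
    have h1 := h g hg (fun z hz => (hfg z hz).trans (min_le_left _ _)) z hz
    have h2 := hfr _ (hfD.iterate n hz) _ (hg.iterate n hz) (by rwa [dist_eq_norm])
    have h3 := (hfg _ (hg.iterate n hz)).trans (min_le_right _ _)
    rw [dist_eq_norm] at h2
    rw [Function.iterate_succ_apply', Function.iterate_succ_apply']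
    have := norm_sub_le_norm_sub_add_norm_sub (f (f^[n] z)) (f (g^[n] z)) (g (g^[n] z))
    linarith

theorem exists_forall_birkhoffSum_sub_le {f : ℂ → ℂ} {ψ : ℂ → ℝ} (hf : ContinuousOn f Disk)
    (hfD : MapsTo f Disk Disk) (hψ : ContinuousOn ψ Disk) (n : ℕ) {ε : ℝ} (hε : 0 < ε) :
    ∃ δ > 0, ∀ g : ℂ → ℂ, MapsTo g Disk Disk → (∀ z ∈ Disk, ‖f z - g z‖ ≤ δ) →
      ∀ z ∈ Disk, |birkhoffSum f ψ n z - birkhoffSum g ψ n z| ≤ n * ε := by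
  induction n with
  | zero => exact ⟨1, one_pos, fun g _ _ z _ => by simp⟩
  | succ n ih =>
    obtain ⟨r, hr, hψr⟩ := Metric.uniformContinuousOn_iff_le.1
      (isCompact_disk.uniformContinuousOn_of_continuous hψ) ε hε
    obtain ⟨δ₁, hδ₁, h₁⟩ := ih
    obtain ⟨δ₂, hδ₂, h₂⟩ := exists_forall_iterate_sub_le hf hfD n hr
    refine ⟨min δ₁ δ₂, lt_min hδ₁ hδ₂, fun g hg hfg z hz => ?_⟩
    have h1 := h₁ g hg (fun z hz => (hfg z hz).trans (min_le_left _ _)) z hz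
    have h2 := h₂ g hg (fun z hz => (hfg z hz).trans (min_le_right _ _)) z hz
    have h3 := hψr _ (hfD.iterate n hz) _ (hg.iterate n hz) (by rwa [dist_eq_norm])
    rw [Real.dist_eq] at h3
    rw [birkhoffSum_succ, birkhoffSum_succ]
    push_cast
    rw [abs_le] at h1 h3 ⊢
    constructor <;> linarith [h1.1, h1.2, h3.1, h3.2]

/-- The mean of a normalized action function of `f` against an invariant circle measure of a
nearby diffeomorphism is small. -/
theorem IsNormalizedAction.exists_forall_abs_integral_le {f : SympDiff} {A : ℂ → ℝ}
    (hA : IsNormalizedAction f A) {ε : ℝ} (hε : 0 < ε) :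
    ∃ δ > 0, ∀ g : SympDiff, (∀ z ∈ Disk, ‖f.toFun z - g.toFun z‖ ≤ δ) →
      ∀ μ, IsInvariantCircleMeasure g μ → |∫ z, A z ∂μ| ≤ ε := by
  obtain ⟨n, hn⟩ := exists_nat_gt (4 / ε)
  have hn0 : (0 : ℝ) < n := (by positivity : 0 < 4 / ε).trans hn
  obtain ⟨δ, hδ, h⟩ := exists_forall_birkhoffSum_sub_le f.continuousOn f.mapsTo
    hA.1.continuousOn n (half_pos hε)
  refine ⟨δ, hδ, fun g hg μ hμ => ?_⟩
  have hc := hA.1.continuousOn.mono circ_subset_disk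
  have h1 := hμ.abs_sub_integral_le (g.continuousOn_birkhoffSum hc n) (a := 0)
    (C := 2 + n * (ε / 2)) fun y hy => by
      have h2 := hA.abs_birkhoffSum_le n hy
      have h3 := h g.toFun g.mapsTo hg y (circ_subset_disk hy)
      rw [abs_le] at h2 h3 ⊢
      constructor <;> linarith [h2.1, h2.2, h3.1, h3.2]
  rw [hμ.integral_birkhoffSum hc, zero_sub, abs_neg, abs_mul, Nat.abs_cast] at h1
  rw [div_lt_iff₀ hε] at hn
  refine le_of_mul_le_mul_left ?_ hn0
  linarith

theorem le_ciSup_disk {u : ℂ → ℝ} (hu : ContinuousOn u Disk) {z : ℂ} (hz : z ∈ Disk) :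
    u z ≤ ⨆ x : Disk, u x := by
  have hb : BddAbove (Set.range fun x : Disk => u x) := by
    have := isCompact_disk.bddAbove_image hu
    rwa [Set.image_eq_range] at this
  exact le_ciSup hb (⟨z, hz⟩ : Disk)

theorem SympDiff.continuousOn_fderivWithin (f : SympDiff) :
    ContinuousOn (fderivWithin ℝ f.toFun Disk) Disk :=
  f.contDiffOn.continuousOn_fderivWithin uniqueDiffOn_disk le_rfl

theorem SympDiff.norm_sub_le_d1 (f g : SympDiff) {z : ℂ} (hz : z ∈ Disk) :
    ‖f.toFun z - g.toFun z‖ ≤ d1 f.toFun f.invFun g.toFun g.invFun :=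
  (le_ciSup_disk (f.continuousOn.sub g.continuousOn).norm hz).trans
    ((le_max_left _ _).trans (le_max_left _ _))

theorem SympDiff.norm_fderivWithin_sub_le_d1 (f g : SympDiff) {z : ℂ} (hz : z ∈ Disk) :
    ‖fderivWithin ℝ f.toFun Disk z - fderivWithin ℝ g.toFun Disk z‖
      ≤ d1 f.toFun f.invFun g.toFun g.invFun :=
  (le_ciSup_disk (f.continuousOn_fderivWithin.sub g.continuousOn_fderivWithin).norm hz).trans
    ((le_max_left _ _).trans (le_max_right _ _))

/-- Action functions of `C¹`-close diffeomorphisms differ by an almost constant function. -/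
theorem IsAction.abs_sub_sub_sub_le {f g : SympDiff} {A B : ℂ → ℝ} (hA : IsAction f A)
    (hB : IsAction g B) {M δ : ℝ} (hM : ∀ z ∈ Disk, ‖fderivWithin ℝ f.toFun Disk z‖ ≤ M)
    (hδ1 : δ ≤ 1) (hd : d1 f.toFun f.invFun g.toFun g.invFun ≤ δ) {x y : ℂ} (hx : x ∈ Disk)
    (hy : y ∈ Disk) : |(B x - A x) - (B y - A y)| ≤ 2 * (δ * (M + 2)) := by
  have hδ0 : 0 ≤ δ := (norm_nonneg _).trans ((f.norm_sub_le_d1 g hx).trans hd)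
  have hM0 : 0 ≤ M := (norm_nonneg _).trans (hM x hx)
  have hC0 : 0 ≤ δ * (M + 2) := by positivity
  have hbound : ∀ z ∈ Disk,
      ‖fderivWithin ℝ B Disk z - fderivWithin ℝ A Disk z‖ ≤ δ * (M + 2) := by
    intro z hz
    refine ContinuousLinearMap.opNorm_le_bound _ hC0 fun w => ?_
    have h1 : ‖g.toFun z - f.toFun z‖ ≤ δ := by
      rw [norm_sub_rev]; exact (f.norm_sub_le_d1 g hz).trans hd
    have h2 : ‖fderivWithin ℝ g.toFun Disk z - fderivWithin ℝ f.toFun Disk z‖ ≤ δ := by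
      rw [norm_sub_rev]; exact (f.norm_fderivWithin_sub_le_d1 g hz).trans hd
    have h3 : ‖fderivWithin ℝ g.toFun Disk z‖ ≤ M + 1 := by
      have := norm_le_norm_add_norm_sub' (fderivWithin ℝ g.toFun Disk z)
        (fderivWithin ℝ f.toFun Disk z)
      linarith [hM z hz]
    have e : (fderivWithin ℝ B Disk z - fderivWithin ℝ A Disk z) w
        = lform (g.toFun z - f.toFun z) (fderivWithin ℝ g.toFun Disk z w)
          + lform (f.toFun z)
            ((fderivWithin ℝ g.toFun Disk z - fderivWithin ℝ f.toFun Disk z) w) := by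
      rw [sub_apply, sub_apply, hA.2 z hz, hB.2 z hz,
        ← lform_sub_lform]
      ring
    rw [e, Real.norm_eq_abs]
    refine (abs_add_le _ _).trans ?_
    have h4 := (abs_lform_le (g.toFun z - f.toFun z) (fderivWithin ℝ g.toFun Disk z w)).trans
      (mul_le_mul h1 (ContinuousLinearMap.le_of_opNorm_le _ h3 w) (norm_nonneg _) hδ0)
    have h5 := (abs_lform_le (f.toFun z)
      ((fderivWithin ℝ g.toFun Disk z - fderivWithin ℝ f.toFun Disk z) w)).trans
      (mul_le_mul (norm_le_one_of_mem_disk (f.mapsTo hz))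
        (ContinuousLinearMap.le_of_opNorm_le _ h2 w) (norm_nonneg _) zero_le_one)
    linarith
  have hmv := convex_disk.norm_image_sub_le_of_norm_hasFDerivWithin_le
    (f := fun z => B z - A z)
    (fun z hz => (hB.hasFDerivWithinAt hz).sub (hA.hasFDerivWithinAt hz)) hbound hy hx
  have hxy : ‖x - y‖ ≤ 2 := (norm_sub_le x y).trans (by
    linarith [norm_le_one_of_mem_disk hx, norm_le_one_of_mem_disk hy])
  rw [Real.norm_eq_abs] at hmv
  refine hmv.trans ?_
  rw [mul_comm 2]
  exact mul_le_mul_of_nonneg_left hxy hC0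

theorem measureReal_disk : volume.real Disk = Real.pi := by
  simp [Measure.real, Disk, Complex.volume_closedBall]

/-- A uniform bound on the disk bounds the normalized integral. -/
theorem abs_integral_disk_sub_le {A B : ℂ → ℝ} (hA : ContinuousOn A Disk)
    (hB : ContinuousOn B Disk) {C : ℝ} (h : ∀ z ∈ Disk, |A z - B z| ≤ C) :
    |(1 / Real.pi) * ∫ z in Disk, (A z - (1 / Real.pi) * ∫ z in Disk, B z)| ≤ C := by
  have hAi : IntegrableOn A Disk volume := hA.integrableOn_compact isCompact_disk
  have hBi : IntegrableOn B Disk volume := hB.integrableOn_compact isCompact_disk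
  have hfin : volume Disk < ⊤ := isCompact_disk.measure_lt_top
  have hpi := Real.pi_pos
  have hconst : IntegrableOn (fun _ => (1 / Real.pi) * ∫ z in Disk, B z) Disk volume :=
    integrableOn_const hfin.ne
  have e : ∫ z in Disk, (A z - (1 / Real.pi) * ∫ z in Disk, B z)
      = ∫ z in Disk, (A z - B z) := by
    rw [integral_sub hAi hconst, integral_sub hAi hBi, setIntegral_const, measureReal_disk,
      smul_eq_mul]
    field_simp
  have hle := norm_setIntegral_le_of_norm_le_const (f := fun z => A z - B z) hfin h
  rw [measureReal_disk, Real.norm_eq_abs] at hle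
  rw [e, abs_mul, abs_of_pos (by positivity : 0 < 1 / Real.pi), one_div_mul_eq_div,
    div_le_iff₀ hpi]
  exact hle

/-- Normalized action functions of `C¹`-close diffeomorphisms are uniformly close. -/
theorem IsNormalizedAction.exists_forall_abs_sub_le {f : SympDiff} {A : ℂ → ℝ}
    (hA : IsNormalizedAction f A) {ε : ℝ} (hε : 0 < ε) :
    ∃ δ > 0, ∀ g : SympDiff, d1 f.toFun f.invFun g.toFun g.invFun ≤ δ →
      ∀ B, IsNormalizedAction g B → ∀ z ∈ Disk, |A z - B z| ≤ ε := by
  obtain ⟨M, hM⟩ := isCompact_disk.exists_bound_of_continuousOn f.continuousOn_fderivWithin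
  have hM0 : 0 ≤ M := (norm_nonneg _).trans (hM _ (circleParam_mem_disk 0))
  obtain ⟨δ, hδ, h⟩ := hA.exists_forall_abs_integral_le (half_pos hε)
  refine ⟨min δ (min 1 (ε / (4 * (M + 2)))), by positivity, fun g hg B hB z hz => ?_⟩
  obtain ⟨hB, μ, hμ, h0⟩ := hB
  have h1 := h g (fun z hz => (f.norm_sub_le_d1 g hz).trans (hg.trans (min_le_left _ _))) μ hμ
  have hgδ := hg.trans (min_le_right _ _)
  have hAc := hA.1.continuousOn.mono circ_subset_disk
  have hBc := hB.continuousOn.mono circ_subset_disk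
  have h2 := hμ.abs_sub_integral_le (hBc.sub hAc) fun y hy =>
    hA.1.abs_sub_sub_sub_le hB hM (min_le_left _ _) hgδ hz (circ_subset_disk hy)
  have h3 : 2 * (min 1 (ε / (4 * (M + 2))) * (M + 2)) ≤ ε / 2 := by
    have h4 : ε / (4 * (M + 2)) * (M + 2) = ε / 4 := by field_simp
    have h5 := mul_le_mul_of_nonneg_right (min_le_right 1 (ε / (4 * (M + 2))))
      (by positivity : 0 ≤ M + 2)
    linarith
  have h4 : ∫ y, (B - A) y ∂μ = -∫ y, A y ∂μ := by
    simp only [Pi.sub_apply]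
    rw [integral_sub (hμ.integrable hBc) (hμ.integrable hAc), h0, zero_sub]
  simp only [← Pi.sub_apply] at h2
  change |B z - A z - ∫ y, (B - A) y ∂μ| ≤ _ at h2
  rw [h4] at h2
  rw [abs_le] at h1 h2 ⊢
  constructor <;> linarith [h1.1, h1.2, h2.1, h2.2]

/-- `Cal₁ : Diff¹_ω(D) → ℝ` is continuous for the `C¹` distance `d₁`. -/
theorem cal_continuous_C1 (f : SympDiff) (ε : ℝ) (hε : 0 < ε) :
    ∃ δ : ℝ, 0 < δ ∧
      ∀ g : SympDiff, d1 f.toFun f.invFun g.toFun g.invFun ≤ δ →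
        ∀ Af Ag : ℂ → ℝ, IsNormalizedAction f Af → IsNormalizedAction g Ag →
          |(1 / Real.pi) * ∫ z in Disk, Af z - (1 / Real.pi) * ∫ z in Disk, Ag z| ≤ ε := by
  by_cases hA : ∃ A, IsNormalizedAction f A
  · obtain ⟨A, hA⟩ := hA
    obtain ⟨δ, hδ, h⟩ := hA.exists_forall_abs_sub_le (half_pos hε)
    refine ⟨δ, hδ, fun g hg Af Ag hAf hAg => ?_⟩
    have hff : d1 f.toFun f.invFun f.toFun f.invFun ≤ δ := by
      simpa [d1, d0] using hδ.le
    refine abs_integral_disk_sub_le hAf.1.continuousOn hAg.1.continuousOn fun z hz => ?_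
    have h1 := h f hff Af hAf z hz
    have h2 := h g hg Ag hAg z hz
    rw [abs_le] at h1 h2 ⊢
    constructor <;> linarith [h1.1, h1.2, h2.1, h2.2]
  · exact ⟨1, one_pos, fun g _ Af _ hAf => (hA ⟨Af, hAf⟩).elim⟩
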